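/- The quasi-shuffle product splits into three binary operations: u ⋆ v = u ⋖ v + u ⋗ v + u ⋄ v for nonempty words u, v, where ua ⋗ vb := (ua ⋆ v)b, ua ⋖ vb := (u ⋆ vb)a, ua ⋄ vb := (u ⋆ v)[ab]; these satisfy ua ⋗ vb = vb ⋖ ua, and (T₊(𝔄), ⋖, ⋗, ⋄) is a commutative tridendriform algebra in the sense of Loday–Ronco, i.e., for all nonempty words x, y, z: (x⋖y)⋖z = x⋖(y⋆z), (x⋗y)⋖z = x⋗(y⋖z), x⋗(y⋗z) = (x⋆y)⋗z, (x⋗y)⋄z = x⋗(y⋄z), (x⋖y)⋄z = x⋄(y⋗z), (x⋄y)⋖z = x⋄(y⋖z), and (x⋄y)⋄z = x⋄(y⋄z). -/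

import Mathlib

noncomputable section

open scoped BigOperators

namespace TimeWarp

/-- The free commutative semigroup `𝔄` on the alphabet `A = {1,…,d}` (modelled as `Fin d`):
its elements are the nonempty finite multisets of letters, multiplied by union. -/
abbrev Bracket (d : ℕ) := {m : Multiset (Fin d) // m ≠ 0}

instance {d : ℕ} : Mul (Bracket d) :=
  ⟨fun a b => ⟨a.1 + b.1, fun h => a.2 (by
    have hc := Multiset.card_add a.1 b.1
    rw [h] at hc
    simp at hc
    exact Multiset.card_eq_zero.mp (by omega))⟩⟩

/-- Words with letters in the semigroup `𝔄`; the basis of the tensor algebra `T(𝔄)`. -/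
abbrev Word (d : ℕ) := List (Bracket d)

/-- The tensor algebra `T(𝔄)`, as the free vector space on words. -/
abbrev TA (K : Type*) [Field K] (d : ℕ) := Word d →₀ K

/-- The weight grading: each bracket has weight the number of letters in it. -/
def wordWeight {d : ℕ} (w : Word d) : ℕ := (w.map fun a => Multiset.card a.1).sum

variable {K : Type*} [Field K] {d : ℕ}
/-- Quasi-shuffle product on (reversed) words: the head of the list is the *last* letter
of the word.  `qshRev (u ++ [a]).reverse (v ++ [b]).reverse` encodes
`ua ⋆ vb = (u ⋆ vb)a + (ua ⋆ v)b + (u ⋆ v)[ab]`. -/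
def qshRev : Word d → Word d → TA K d
  | [], v => Finsupp.single v 1
  | u, [] => Finsupp.single u 1
  | a :: u, b :: v =>
      Finsupp.mapDomain (a :: ·) (qshRev u (b :: v)) +
      Finsupp.mapDomain (b :: ·) (qshRev (a :: u) v) +
      Finsupp.mapDomain ((a * b) :: ·) (qshRev u v)
termination_by u v => u.length + v.length
decreasing_by all_goals (simp only [List.length_cons]; omega)

/-- The quasi-shuffle product `u ⋆ v` of two words, an element of `T(𝔄)`. -/
def qshW (u v : Word d) : TA K d :=
  Finsupp.mapDomain List.reverse (qshRev u.reverse v.reverse)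

/-- The bilinear extension of the quasi-shuffle product to all of `T(𝔄)`. -/
def qshL (f g : TA K d) : TA K d :=
  f.sum fun u cu => g.sum fun v cv => (cu * cv) • qshW u v
/-- Right quasi half-shuffle on words: `ua ⋗ vb := (ua ⋆ v)b` (zero if the second word is empty). -/
def rSuccQ (u v : Word d) : TA K d :=
  match v.getLast? with
  | none => 0
  | some b => Finsupp.mapDomain (· ++ [b]) (qshW u v.dropLast)

/-- Left quasi half-shuffle on words: `ua ⋖ vb := (u ⋆ vb)a` (zero if the first word is empty). -/
def lPrecQ (u v : Word d) : TA K d :=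
  match u.getLast? with
  | none => 0
  | some a => Finsupp.mapDomain (· ++ [a]) (qshW u.dropLast v)

/-- Diamond part of the quasi-shuffle: `ua ⋄ vb := (u ⋆ v)[ab]` (zero if either word is empty). -/
def diamQ (u v : Word d) : TA K d :=
  match u.getLast?, v.getLast? with
  | some a, some b => Finsupp.mapDomain (· ++ [a * b]) (qshW u.dropLast v.dropLast)
  | _, _ => 0

/-- Bilinear extension of `⋗`. -/
def rSuccL (f g : TA K d) : TA K d :=
  f.sum fun u cu => g.sum fun v cv => (cu * cv) • rSuccQ u v

/-- Bilinear extension of `⋖`. -/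
def lPrecL (f g : TA K d) : TA K d :=
  f.sum fun u cu => g.sum fun v cv => (cu * cv) • lPrecQ u v

/-- Bilinear extension of `⋄`. -/
def diamL (f g : TA K d) : TA K d :=
  f.sum fun u cu => g.sum fun v cv => (cu * cv) • diamQ u v

/-- Dirac element of a word in `T(𝔄)`. -/
def deltaW (w : Word d) : TA K d := Finsupp.single w 1

theorem bracket_mul_comm (a b : Bracket d) : a * b = b * a :=
  Subtype.ext (add_comm a.1 b.1)

theorem bracket_mul_assoc (a b c : Bracket d) : a * b * c = a * (b * c) :=
  Subtype.ext (add_assoc a.1 b.1 c.1)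

/-- Appending the letter `a` at the end of words, as a linear map on `T(𝔄)`. -/
def snoc (a : Bracket d) : TA K d →ₗ[K] TA K d :=
  Finsupp.lmapDomain K K (· ++ [a])

theorem snoc_deltaW (a : Bracket d) (u : Word d) :
    snoc a (deltaW (K := K) u) = deltaW (u ++ [a]) := by
  simp [snoc, deltaW, Finsupp.mapDomain_single]

/-- The bilinear map on `T(𝔄)` with prescribed values on pairs of words. -/
def bilinExt (B : Word d → Word d → TA K d) : TA K d →ₗ[K] TA K d →ₗ[K] TA K d :=
  Finsupp.linearCombination K fun u => Finsupp.linearCombination K (B u)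

theorem bilinExt_apply (B : Word d → Word d → TA K d) (f g : TA K d) :
    bilinExt B f g = f.sum fun u cu => g.sum fun v cv => (cu * cv) • B u v := by
  simp [bilinExt, Finsupp.linearCombination_apply, Finsupp.sum, LinearMap.sum_apply,
    Finset.smul_sum, mul_smul]

@[simp]
theorem bilinExt_deltaW (B : Word d → Word d → TA K d) (u v : Word d) :
    bilinExt B (deltaW u) (deltaW v) = B u v := by
  simp [bilinExt, deltaW]

theorem linearMap_ext_deltaW {M : Type*} [AddCommMonoid M] [Module K M] {φ ψ : TA K d →ₗ[K] M}
    (h : ∀ u, φ (deltaW u) = ψ (deltaW u)) : φ = ψ :=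
  Finsupp.lhom_ext' fun u => LinearMap.ext_ring (h u)

theorem bilin_ext_deltaW {M : Type*} [AddCommMonoid M] [Module K M]
    {φ ψ : TA K d →ₗ[K] TA K d →ₗ[K] M}
    (h : ∀ u v, φ (deltaW u) (deltaW v) = ψ (deltaW u) (deltaW v)) (f g : TA K d) :
    φ f g = ψ f g := by
  have : φ = ψ := linearMap_ext_deltaW fun u => linearMap_ext_deltaW (h u)
  rw [this]

theorem qshRev_nil_right (u : Word d) : qshRev (K := K) u [] = Finsupp.single u 1 := by
  cases u <;> simp [qshRev]

theorem qshRev_comm (u v : Word d) : qshRev (K := K) u v = qshRev v u := by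
  induction u generalizing v with
  | nil => rw [qshRev_nil_right, qshRev]
  | cons a u ihu =>
    induction v with
    | nil => rw [qshRev_nil_right, qshRev]
    | cons b v ihv =>
      rw [qshRev, qshRev, ihu, ihu, ihv, bracket_mul_comm a b]
      abel

theorem qshW_comm (u v : Word d) : qshW (K := K) u v = qshW v u := by
  rw [qshW, qshW, qshRev_comm]

theorem qshW_nil_left (v : Word d) : qshW (K := K) [] v = deltaW v := by
  simp [qshW, qshRev, deltaW, Finsupp.mapDomain_single]

theorem qshW_nil_right (u : Word d) : qshW (K := K) u [] = deltaW u := by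
  rw [qshW_comm, qshW_nil_left]

theorem mapDomain_reverse_cons (a : Bracket d) (f : TA K d) :
    Finsupp.mapDomain List.reverse (Finsupp.mapDomain (a :: ·) f) =
      snoc a (Finsupp.mapDomain List.reverse f) := by
  rw [snoc, Finsupp.lmapDomain_apply, ← Finsupp.mapDomain_comp, ← Finsupp.mapDomain_comp]
  congr 1
  funext w
  simp

theorem qshW_append_append (u v : Word d) (a b : Bracket d) :
    qshW (K := K) (u ++ [a]) (v ++ [b]) =
      snoc a (qshW u (v ++ [b])) + snoc b (qshW (u ++ [a]) v) + snoc (a * b) (qshW u v) := by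
  simp [qshW, qshRev, Finsupp.mapDomain_add, mapDomain_reverse_cons]

theorem rSuccQ_append (u v : Word d) (b : Bracket d) :
    rSuccQ (K := K) u (v ++ [b]) = snoc b (qshW u v) := by
  simp [rSuccQ, snoc]

theorem lPrecQ_append (u v : Word d) (a : Bracket d) :
    lPrecQ (K := K) (u ++ [a]) v = snoc a (qshW u v) := by
  simp [lPrecQ, snoc]

theorem diamQ_append_append (u v : Word d) (a b : Bracket d) :
    diamQ (K := K) (u ++ [a]) (v ++ [b]) = snoc (a * b) (qshW u v) := by
  simp [diamQ, snoc]

theorem bilinExt_rSuccQ_snoc (b : Bracket d) (f g : TA K d) :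
    bilinExt rSuccQ f (snoc b g) = snoc b (bilinExt qshW f g) :=
  bilin_ext_deltaW (φ := (bilinExt rSuccQ).compl₂ (snoc b))
    (ψ := (bilinExt qshW).compr₂ (snoc b)) (fun u v => by
      simp [snoc_deltaW, rSuccQ_append]) f g

theorem bilinExt_lPrecQ_snoc (a : Bracket d) (f g : TA K d) :
    bilinExt lPrecQ (snoc a f) g = snoc a (bilinExt qshW f g) :=
  bilin_ext_deltaW (φ := (bilinExt lPrecQ).comp (snoc a))
    (ψ := (bilinExt qshW).compr₂ (snoc a)) (fun u v => by
      simp [snoc_deltaW, lPrecQ_append]) f g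

theorem bilinExt_diamQ_snoc_snoc (a b : Bracket d) (f g : TA K d) :
    bilinExt diamQ (snoc a f) (snoc b g) = snoc (a * b) (bilinExt qshW f g) :=
  bilin_ext_deltaW (φ := (bilinExt diamQ).compl₁₂ (snoc a) (snoc b))
    (ψ := (bilinExt qshW).compr₂ (snoc (a * b))) (fun u v => by
      simp [snoc_deltaW, diamQ_append_append]) f g

theorem bilinExt_qshW_snoc_snoc (a b : Bracket d) (f g : TA K d) :
    bilinExt qshW (snoc a f) (snoc b g) = snoc a (bilinExt qshW f (snoc b g)) +
      snoc b (bilinExt qshW (snoc a f) g) + snoc (a * b) (bilinExt qshW f g) := by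
  have := bilin_ext_deltaW (M := TA K d) (φ := (bilinExt qshW).compl₁₂ (snoc a) (snoc b))
    (ψ := ((bilinExt qshW).compl₂ (snoc b)).compr₂ (snoc a) +
      ((bilinExt qshW).comp (snoc a)).compr₂ (snoc b) +
      (bilinExt qshW).compr₂ (snoc (a * b))) (fun u v => by
      simp [snoc_deltaW, qshW_append_append]) f g
  rw [LinearMap.add_apply, LinearMap.add_apply] at this
  exact this

theorem bilinExt_qshW_snoc_assoc_left (a b c : Bracket d) (f g h : TA K d) :
    bilinExt qshW (bilinExt qshW (snoc a f) (snoc b g)) (snoc c h) =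
      snoc a (bilinExt qshW (bilinExt qshW f (snoc b g)) (snoc c h)) +
      snoc b (bilinExt qshW (bilinExt qshW (snoc a f) g) (snoc c h)) +
      snoc c (bilinExt qshW (bilinExt qshW (snoc a f) (snoc b g)) h) +
      snoc (a * b) (bilinExt qshW (bilinExt qshW f g) (snoc c h)) +
      snoc (a * c) (bilinExt qshW (bilinExt qshW f (snoc b g)) h) +
      snoc (b * c) (bilinExt qshW (bilinExt qshW (snoc a f) g) h) +
      snoc (a * b * c) (bilinExt qshW (bilinExt qshW f g) h) := by
  simp only [bilinExt_qshW_snoc_snoc, map_add, LinearMap.add_apply]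
  abel

theorem bilinExt_qshW_snoc_assoc_right (a b c : Bracket d) (f g h : TA K d) :
    bilinExt qshW (snoc a f) (bilinExt qshW (snoc b g) (snoc c h)) =
      snoc a (bilinExt qshW f (bilinExt qshW (snoc b g) (snoc c h))) +
      snoc b (bilinExt qshW (snoc a f) (bilinExt qshW g (snoc c h))) +
      snoc c (bilinExt qshW (snoc a f) (bilinExt qshW (snoc b g) h)) +
      snoc (a * b) (bilinExt qshW f (bilinExt qshW g (snoc c h))) +
      snoc (a * c) (bilinExt qshW f (bilinExt qshW (snoc b g) h)) +
      snoc (b * c) (bilinExt qshW (snoc a f) (bilinExt qshW g h)) +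
      snoc (a * (b * c)) (bilinExt qshW f (bilinExt qshW g h)) := by
  simp only [bilinExt_qshW_snoc_snoc, map_add]
  abel

theorem bilinExt_qshW_nil_left (f : TA K d) : bilinExt qshW (deltaW []) f = f := by
  have : bilinExt qshW (deltaW []) = (LinearMap.id : TA K d →ₗ[K] TA K d) :=
    linearMap_ext_deltaW fun u => by simp [qshW_nil_left]
  rw [this, LinearMap.id_apply]

theorem bilinExt_qshW_nil_right (f : TA K d) : bilinExt qshW f (deltaW []) = f := by
  have : (bilinExt qshW).flip (deltaW []) = (LinearMap.id : TA K d →ₗ[K] TA K d) :=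
    linearMap_ext_deltaW fun u => by simp [qshW_nil_right]
  rw [← LinearMap.flip_apply, this, LinearMap.id_apply]

theorem bilinExt_qshW_assoc_deltaW (x y z : Word d) :
    bilinExt qshW (bilinExt qshW (deltaW (K := K) x) (deltaW y)) (deltaW z) =
      bilinExt qshW (deltaW x) (bilinExt qshW (deltaW y) (deltaW z)) := by
  induction x using List.reverseRecOn generalizing y z with
  | nil => simp only [bilinExt_qshW_nil_left]
  | append_singleton u a ihx =>
    induction y using List.reverseRecOn generalizing z with
    | nil => simp only [bilinExt_qshW_nil_left, bilinExt_qshW_nil_right]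
    | append_singleton v b ihy =>
      induction z using List.reverseRecOn with
      | nil => simp only [bilinExt_qshW_nil_right]
      | append_singleton w c ihz =>
        simp only [← snoc_deltaW] at ihy ihz ⊢
        rw [bilinExt_qshW_snoc_assoc_left, bilinExt_qshW_snoc_assoc_right, ihz, bracket_mul_assoc]
        simp only [snoc_deltaW] at ihy ⊢
        simp only [ihx, ihy]

theorem rSuccL_eq_bilinExt (f g : TA K d) : rSuccL f g = bilinExt rSuccQ f g :=
  (bilinExt_apply _ f g).symm

theorem lPrecL_eq_bilinExt (f g : TA K d) : lPrecL f g = bilinExt lPrecQ f g :=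
  (bilinExt_apply _ f g).symm

theorem diamL_eq_bilinExt (f g : TA K d) : diamL f g = bilinExt diamQ f g :=
  (bilinExt_apply _ f g).symm

theorem exists_eq_append_singleton {u : Word d} (hu : u ≠ []) : ∃ v a, u = v ++ [a] :=
  ⟨u.dropLast, u.getLast hu, (List.dropLast_append_getLast hu).symm⟩

/-- The quasi-shuffle product splits into the half-shuffles `⋖`, `⋗` and the product `⋄`,
with `ua ⋗ vb = vb ⋖ ua`, and `(T₊(𝔄), ⋖, ⋗, ⋄)` is a commutative tridendriform algebra
in the sense of Loday–Ronco. -/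
theorem quasi_shuffle_tridendriform {K : Type*} [Field K] [CharZero K] {d : ℕ} :
    -- splitting: u ⋆ v = u ⋖ v + u ⋗ v + u ⋄ v
    (∀ u v : Word d, u ≠ [] → v ≠ [] →
        qshW (K := K) u v = lPrecQ u v + rSuccQ u v + diamQ u v) ∧
    -- ua ⋗ vb = vb ⋖ ua
    (∀ u v : Word d, u ≠ [] → v ≠ [] → rSuccQ (K := K) u v = lPrecQ v u) ∧
    -- tridendriform axioms
    (∀ x y z : Word d, x ≠ [] → y ≠ [] → z ≠ [] →
        lPrecL (lPrecQ (K := K) x y) (deltaW z) = lPrecL (deltaW x) (qshW y z)) ∧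
    (∀ x y z : Word d, x ≠ [] → y ≠ [] → z ≠ [] →
        lPrecL (rSuccQ (K := K) x y) (deltaW z) = rSuccL (deltaW x) (lPrecQ y z)) ∧
    (∀ x y z : Word d, x ≠ [] → y ≠ [] → z ≠ [] →
        rSuccL (deltaW (K := K) x) (rSuccQ y z) = rSuccL (qshW x y) (deltaW z)) ∧
    (∀ x y z : Word d, x ≠ [] → y ≠ [] → z ≠ [] →
        diamL (rSuccQ (K := K) x y) (deltaW z) = rSuccL (deltaW x) (diamQ y z)) ∧
    (∀ x y z : Word d, x ≠ [] → y ≠ [] → z ≠ [] →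
        diamL (lPrecQ (K := K) x y) (deltaW z) = diamL (deltaW x) (rSuccQ y z)) ∧
    (∀ x y z : Word d, x ≠ [] → y ≠ [] → z ≠ [] →
        lPrecL (diamQ (K := K) x y) (deltaW z) = diamL (deltaW x) (lPrecQ y z)) ∧
    (∀ x y z : Word d, x ≠ [] → y ≠ [] → z ≠ [] →
        diamL (diamQ (K := K) x y) (deltaW z) = diamL (deltaW x) (diamQ y z)) := by
  simp only [rSuccL_eq_bilinExt, lPrecL_eq_bilinExt, diamL_eq_bilinExt]
  refine ⟨fun u v hu hv => ?_, fun u v _ hv => ?_, fun x y z hx _ _ => ?_, fun x y z _ hy _ => ?_,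
    fun x y z _ _ hz => ?_, fun x y z _ hy hz => ?_, fun x y z hx hy hz => ?_,
    fun x y z hx hy _ => ?_, fun x y z hx hy hz => ?_⟩
  · obtain ⟨u, a, rfl⟩ := exists_eq_append_singleton hu
    obtain ⟨v, b, rfl⟩ := exists_eq_append_singleton hv
    rw [qshW_append_append, lPrecQ_append, rSuccQ_append, diamQ_append_append]
  · obtain ⟨v, b, rfl⟩ := exists_eq_append_singleton hv
    rw [rSuccQ_append, lPrecQ_append, qshW_comm]
  · obtain ⟨u, a, rfl⟩ := exists_eq_append_singleton hx
    rw [lPrecQ_append, ← snoc_deltaW, bilinExt_lPrecQ_snoc, bilinExt_lPrecQ_snoc,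
      ← bilinExt_deltaW qshW, ← bilinExt_deltaW qshW, bilinExt_qshW_assoc_deltaW]
  · obtain ⟨v, b, rfl⟩ := exists_eq_append_singleton hy
    rw [rSuccQ_append, lPrecQ_append, bilinExt_lPrecQ_snoc, bilinExt_rSuccQ_snoc,
      ← bilinExt_deltaW qshW, ← bilinExt_deltaW qshW, bilinExt_qshW_assoc_deltaW]
  · obtain ⟨w, c, rfl⟩ := exists_eq_append_singleton hz
    rw [rSuccQ_append, ← snoc_deltaW, bilinExt_rSuccQ_snoc, bilinExt_rSuccQ_snoc,
      ← bilinExt_deltaW qshW, ← bilinExt_deltaW qshW, bilinExt_qshW_assoc_deltaW]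
  · obtain ⟨v, b, rfl⟩ := exists_eq_append_singleton hy
    obtain ⟨w, c, rfl⟩ := exists_eq_append_singleton hz
    rw [rSuccQ_append, diamQ_append_append, ← snoc_deltaW, bilinExt_diamQ_snoc_snoc,
      bilinExt_rSuccQ_snoc, ← bilinExt_deltaW qshW, ← bilinExt_deltaW qshW,
      bilinExt_qshW_assoc_deltaW]
  · obtain ⟨u, a, rfl⟩ := exists_eq_append_singleton hx
    obtain ⟨w, c, rfl⟩ := exists_eq_append_singleton hz
    rw [lPrecQ_append, rSuccQ_append, ← snoc_deltaW, ← snoc_deltaW, bilinExt_diamQ_snoc_snoc,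
      bilinExt_diamQ_snoc_snoc, ← bilinExt_deltaW qshW, ← bilinExt_deltaW qshW,
      bilinExt_qshW_assoc_deltaW]
  · obtain ⟨u, a, rfl⟩ := exists_eq_append_singleton hx
    obtain ⟨v, b, rfl⟩ := exists_eq_append_singleton hy
    rw [diamQ_append_append, lPrecQ_append, ← snoc_deltaW, bilinExt_lPrecQ_snoc,
      bilinExt_diamQ_snoc_snoc, ← bilinExt_deltaW qshW, ← bilinExt_deltaW qshW,
      bilinExt_qshW_assoc_deltaW]
  · obtain ⟨u, a, rfl⟩ := exists_eq_append_singleton hx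
    obtain ⟨v, b, rfl⟩ := exists_eq_append_singleton hy
    obtain ⟨w, c, rfl⟩ := exists_eq_append_singleton hz
    rw [diamQ_append_append, diamQ_append_append, ← snoc_deltaW, ← snoc_deltaW,
      bilinExt_diamQ_snoc_snoc, bilinExt_diamQ_snoc_snoc, ← bilinExt_deltaW qshW,
      ← bilinExt_deltaW qshW, bilinExt_qshW_assoc_deltaW, bracket_mul_assoc]

end TimeWarp
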